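/- arXiv:1404.0660 — 4 statements merged into one kernel-verified Lean document; each statement's English description precedes it below -/
import Mathlib

section
/- Let θ > 0 be fixed and let S : (1,∞) → (0,∞) satisfy S(x) = O(x) as x → ∞. For each pair α, β > 0 with αβ > 1 let v = v(αβ) > θ²·ρ^{−1} be the (unique) water level satisfying S(αβ) = ∑_{k=0}^∞ (v − θ²·ρ^{−(2k+1)})⁺, and define C(αβ) = ∑_{k=0}^∞ (1/2)·ln_+( v·ρ^{2k+1} / θ² ). Set N(t,ω) = (θ²/(2π))·cosh δ · exp(t²/α² + ω²/β²) and ν = ν(αβ) = v(αβ)/(2π). Then C ≐ (1/(2π)) ∬_{ℝ²} (1/2)·ln( 1 + (ν − N(t,ω))⁺ / N(t,ω) ) dt dω, i.e., the difference between the two sides is o(αβ) as αβ → ∞. -/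
open MeasureTheory

/-- `dlt x` is δ = arccoth x, i.e. the positive solution of coth δ = x for x > 1. -/
noncomputable def dlt (x : ℝ) : ℝ := (1/2) * Real.log ((x + 1) / (x - 1))

/-- `rho x` is ρ = e^{-δ} where coth δ = x. -/
noncomputable def rho (x : ℝ) : ℝ := Real.exp (-dlt x)

/-- `lnplus x = max {0, ln x}` (with `lnplus 0 = 0`, since `Real.log 0 = 0`). -/
noncomputable def lnplus (x : ℝ) : ℝ := max 0 (Real.log x)

theorem dlt_bounds {x : ℝ} (hx : 1 < x) : 1 / (x + 1) ≤ dlt x ∧ dlt x ≤ 1 / (x - 1) := by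
  have h1 : 0 < x - 1 := by linarith
  have h2 : 0 < x + 1 := by linarith
  have hq : 0 < (x + 1) / (x - 1) := div_pos h2 h1
  have hu := Real.log_le_sub_one_of_pos hq
  have hl := Real.one_sub_inv_le_log_of_pos hq
  have e1 : (x + 1) / (x - 1) - 1 = 2 * (1 / (x - 1)) := by field_simp; ring
  have e2 : 1 - ((x + 1) / (x - 1))⁻¹ = 2 * (1 / (x + 1)) := by field_simp; ring
  unfold dlt
  constructor <;> linarith

theorem sub_odd_mul_nonpos {δ : ℝ} (hδ : 0 < δ) (L : ℝ) {k : ℕ}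
    (hk : k ∉ Finset.range ⌈(L - δ) / (2 * δ)⌉₊) : L - (2 * k + 1) * δ ≤ 0 := by
  rw [Finset.mem_range, not_lt, Nat.ceil_le, div_le_iff₀ (by positivity)] at hk
  linarith

/-- The midpoint rule for `u ↦ (L - u)⁺` with step `2δ`. -/
theorem abs_tsum_posPart_odd_sub_le {δ L : ℝ} (hδ : 0 < δ) (hL : δ ≤ L) :
    |(∑' k : ℕ, (1 / 2) * max 0 (L - (2 * k + 1) * δ)) - L ^ 2 / (8 * δ)| ≤ δ / 8 := by
  set n := ⌈(L - δ) / (2 * δ)⌉₊ with hn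
  have hsum : (∑' k : ℕ, (1 / 2) * max 0 (L - (2 * k + 1) * δ)) = (n * L - n ^ 2 * δ) / 2 := by
    rw [tsum_eq_sum (s := Finset.range n) fun k hk => by
      rw [max_eq_left (sub_odd_mul_nonpos hδ L hk), mul_zero]]
    have h : ∀ k ∈ Finset.range n,
        (1 / 2) * max 0 (L - (2 * (k : ℝ) + 1) * δ) = (1 / 2) * (L - (2 * k + 1) * δ) := by
      intro k hk
      rw [Finset.mem_range, hn, Nat.lt_ceil, lt_div_iff₀ (by positivity)] at hk
      rw [max_eq_right (by linarith)]
    rw [Finset.sum_congr rfl h]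
    generalize n = m
    induction m with
    | zero => simp
    | succ m ih => rw [Finset.sum_range_succ, ih]; push_cast; ring
  have hlow : (L - δ) / (2 * δ) ≤ n := Nat.le_ceil _
  have hupp : (n : ℝ) < (L - δ) / (2 * δ) + 1 :=
    Nat.ceil_lt_add_one (div_nonneg (by linarith) (by positivity))
  have hmid : (L - δ) / (2 * δ) = L / (2 * δ) - 1 / 2 := by field_simp
  have hdiff : (n * L - n ^ 2 * δ) / 2 - L ^ 2 / (8 * δ)
      = -(δ / 2 * (n - L / (2 * δ)) ^ 2) := by field_simp; ring
  have hsq : (n - L / (2 * δ)) ^ 2 ≤ 1 / 4 := by nlinarith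
  rw [hsum, hdiff, abs_neg, abs_of_nonneg (by positivity)]
  nlinarith

theorem sub_le_exp_sub_exp {u L : ℝ} (hu : 0 ≤ u) (huL : u ≤ L) :
    L - u ≤ Real.exp L - Real.exp u := by
  have h1 := Real.add_one_le_exp (L - u)
  have h2 := Real.one_le_exp hu
  have h3 : Real.exp L = Real.exp u * Real.exp (L - u) := by rw [← Real.exp_add]; ring_nf
  nlinarith

theorem integral_Ioi_mul_posPart_sub_sq {b : ℝ} (hb : 0 ≤ b) :
    ∫ r in Set.Ioi (0 : ℝ), r * max 0 (b - r ^ 2) = b ^ 2 / 4 := by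
  have hs := Real.sq_sqrt hb
  have hs0 := Real.sqrt_nonneg b
  rw [setIntegral_eq_of_subset_of_forall_sdiff_eq_zero (s := Set.Ioc 0 (√b)) measurableSet_Ioi
    (fun r hr => hr.1)]
  · rw [← intervalIntegral.integral_of_le hs0]
    have h : ∀ r ∈ Set.uIcc 0 (√b), r * max 0 (b - r ^ 2) = b * r - r ^ 3 := by
      intro r hr
      rw [Set.uIcc_of_le hs0] at hr
      rw [max_eq_right (by nlinarith [hr.1, hr.2])]
      ring
    rw [intervalIntegral.integral_congr h, intervalIntegral.integral_sub
      (by apply Continuous.intervalIntegrable; fun_prop)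
      (by apply Continuous.intervalIntegrable; fun_prop),
      intervalIntegral.integral_const_mul, integral_id, integral_pow]
    have h4 : √b ^ 4 = b ^ 2 := by rw [← hs]; ring_nf; rw [hs]
    norm_num
    rw [hs, h4]
    ring
  · intro r hr
    have h1 : 0 < r := hr.1
    have h2 : √b < r := by
      by_contra h
      exact hr.2 ⟨h1, not_lt.mp h⟩
    rw [max_eq_left (by nlinarith), mul_zero]

theorem integral_integral_posPart_sub_sq_sub_sq {b : ℝ} (hb : 0 ≤ b) :
    ∫ s : ℝ, ∫ w : ℝ, max 0 (b - (s ^ 2 + w ^ 2)) = Real.pi * b ^ 2 / 2 := by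
  have hint : Integrable (fun p : ℝ × ℝ => max 0 (b - (p.1 ^ 2 + p.2 ^ 2)))
      (volume.prod volume) := by
    refine Continuous.integrable_of_hasCompactSupport (by fun_prop) ?_
    refine HasCompactSupport.of_support_subset_isCompact
      (K := Set.Icc (-√b) (√b) ×ˢ Set.Icc (-√b) (√b)) (isCompact_Icc.prod isCompact_Icc) ?_
    intro p hp
    have hp' : p.1 ^ 2 + p.2 ^ 2 ≤ b := by
      by_contra h
      exact hp (max_eq_left (by linarith))
    exact ⟨abs_le.mp (Real.abs_le_sqrt (by nlinarith)), abs_le.mp (Real.abs_le_sqrt (by nlinarith))⟩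
  rw [← integral_prod (fun p : ℝ × ℝ => max 0 (b - (p.1 ^ 2 + p.2 ^ 2))) hint,
    ← Measure.volume_eq_prod, ← integral_comp_polarCoord_symm]
  have h : ∀ p : ℝ × ℝ, p.1 • max 0 (b - ((polarCoord.symm p).1 ^ 2 + (polarCoord.symm p).2 ^ 2))
      = (p.1 * max 0 (b - p.1 ^ 2)) * 1 := by
    intro p
    have : (p.1 * Real.cos p.2) ^ 2 + (p.1 * Real.sin p.2) ^ 2 = p.1 ^ 2 := by
      have := Real.sin_sq_add_cos_sq p.2
      linear_combination p.1 ^ 2 * this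
    simp [polarCoord_symm_apply, this]
  simp_rw [h]
  rw [polarCoord_target, Measure.volume_eq_prod,
    setIntegral_prod_mul (fun r : ℝ => r * max 0 (b - r ^ 2)) (fun _ : ℝ => (1 : ℝ)),
    integral_Ioi_mul_posPart_sub_sq hb]
  have hpi := Real.pi_pos
  simp only [integral_const, MeasurableSet.univ, measureReal_restrict_apply, Set.univ_inter,
    Real.volume_real_Ioo, smul_eq_mul, mul_one]
  rw [max_eq_left (by linarith)]
  ring

theorem integral_integral_posPart_ellipse {a c b : ℝ} (ha : 0 < a) (hc : 0 < c) (hb : 0 ≤ b) :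
    ∫ t : ℝ, ∫ w : ℝ, (1 / 2) * max 0 (b - (t ^ 2 / a ^ 2 + w ^ 2 / c ^ 2))
      = a * c * (Real.pi * b ^ 2 / 4) := by
  simp_rw [← div_pow]
  have hin : ∀ t : ℝ, ∫ w : ℝ, (1 / 2) * max 0 (b - ((t / a) ^ 2 + (w / c) ^ 2))
      = (1 / 2) * (c * ∫ w : ℝ, max 0 (b - ((t / a) ^ 2 + w ^ 2))) := by
    intro t
    rw [integral_const_mul,
      Measure.integral_comp_div (fun w : ℝ => max 0 (b - ((t / a) ^ 2 + w ^ 2))),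
      abs_of_pos hc, smul_eq_mul]
  simp_rw [hin]
  rw [integral_const_mul, integral_const_mul,
    Measure.integral_comp_div (fun s : ℝ => ∫ w : ℝ, max 0 (b - (s ^ 2 + w ^ 2))),
    abs_of_pos ha, smul_eq_mul, integral_integral_posPart_sub_sq_sub_sq hb]
  ring

theorem log_one_add_posPart_div {u N : ℝ} (hu : 0 < u) (hN : 0 < N) :
    Real.log (1 + max 0 (u - N) / N) = max 0 (Real.log u - Real.log N) := by
  rcases le_total u N with h | h
  · rw [max_eq_left (by linarith), max_eq_left (by linarith [Real.log_le_log hu h])]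
    simp
  · rw [max_eq_right (by linarith), max_eq_right (by linarith [Real.log_le_log hN h]),
      ← Real.log_div hu.ne' hN.ne']
    congr 1
    field_simp
    ring

theorem log_cosh_nonneg (δ : ℝ) : 0 ≤ Real.log (Real.cosh δ) :=
  Real.log_nonneg (Real.one_le_cosh δ)

theorem log_cosh_le {δ : ℝ} (hδ : 0 ≤ δ) : Real.log (Real.cosh δ) ≤ δ := by
  rw [Real.log_le_iff_le_exp (Real.cosh_pos δ), Real.cosh_eq]
  have := Real.exp_le_exp.mpr (show -δ ≤ δ by linarith)
  linarith

theorem sq_le_of_sq_div_le {x δ L a : ℝ} (hδ : 0 < δ) (hδ1 : δ ≤ 1) (hxδ : x * δ ≤ 2)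
    (ha : 0 ≤ a) (h : L ^ 2 / (8 * δ) ≤ a * x / 2 + δ / 8) : L ^ 2 ≤ 8 * a + 1 := by
  rw [div_le_iff₀ (by positivity)] at h
  have h1 : a * (x * δ) ≤ a * 2 := mul_le_mul_of_nonneg_left hxδ ha
  have h2 : δ ^ 2 ≤ 1 := by nlinarith
  linarith

theorem abs_sq_div_sub_mul_sq_le {x δ L l B : ℝ} (hδ : 0 < δ) (hx : 0 < x)
    (hδl : 1 ≤ δ * (x + 1)) (hδu : δ * (x - 1) ≤ 1) (hxδ : x * δ ≤ 2)
    (hl0 : 0 ≤ l) (hlδ : l ≤ δ) (hδL : δ ≤ L) (hLB : L ≤ B) :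
    |L ^ 2 / (8 * δ) - x * (L - l) ^ 2 / 8| ≤ L ^ 2 / 8 + B / 2 := by
  have hscale : |L ^ 2 / (8 * δ) - x * L ^ 2 / 8| ≤ L ^ 2 / 8 := by
    have h1 : |1 / δ - x| ≤ 1 := by
      have hu : 1 / δ ≤ x + 1 := by rw [div_le_iff₀ hδ]; linarith
      have hl : x - 1 ≤ 1 / δ := by rw [le_div_iff₀ hδ]; linarith
      rw [abs_le]
      constructor <;> linarith
    have h2 : L ^ 2 / (8 * δ) - x * L ^ 2 / 8 = L ^ 2 / 8 * (1 / δ - x) := by field_simp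
    rw [h2, abs_mul, abs_of_nonneg (by positivity)]
    exact mul_le_of_le_one_right (by positivity) h1
  have hshift : |x * L ^ 2 / 8 - x * (L - l) ^ 2 / 8| ≤ B / 2 := by
    have h1 : x * L ^ 2 / 8 - x * (L - l) ^ 2 / 8 = (x * l) * (2 * L - l) / 8 := by ring
    have hxl : x * l ≤ 2 := by nlinarith
    have hxl0 : 0 ≤ x * l := by positivity
    have h2 : (x * l) * (2 * L - l) ≤ 2 * (2 * B) :=
      mul_le_mul hxl (by linarith) (by linarith) (by norm_num)
    have h3 : 0 ≤ (x * l) * (2 * L - l) := mul_nonneg hxl0 (by linarith)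
    rw [h1, abs_of_nonneg (by positivity)]
    linarith
  refine (abs_sub_le _ (x * L ^ 2 / 8) _).trans ?_
  linarith

/-- Capacity half of the waterfilling theorem for the heat channel:
`C ≐ (1/(2π)) ∬ (1/2) ln(1 + (ν − N(t,ω))⁺/N(t,ω)) dt dω` as `αβ → ∞`. -/
theorem heat_channel_capacity_waterfilling
    (θ : ℝ) (hθ : 0 < θ)
    (S : ℝ → ℝ) (hSpos : ∀ x, 1 < x → 0 < S x)
    (hSO : ∃ c M : ℝ, 1 < M ∧ ∀ x, M < x → |S x| ≤ c * x)
    (v : ℝ → ℝ)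
    (hv : ∀ x, 1 < x → θ^2 / rho x < v x)
    (hvS : ∀ x, 1 < x → (∑' k : ℕ, max 0 (v x - θ^2 / (rho x)^(2*k+1))) = S x)
    (C : ℝ → ℝ)
    (hC : ∀ x, 1 < x → C x = ∑' k : ℕ, (1/2) * lnplus (v x * (rho x)^(2*k+1) / θ^2)) :
    ∀ ε > 0, ∃ M, 1 < M ∧ ∀ α β : ℝ, 0 < α → 0 < β → M < α * β →
      |C (α * β) -
        (1/(2*Real.pi)) * ∫ t : ℝ, ∫ ω : ℝ,
          (1/2) * Real.log (1 +
            (max 0 (v (α*β)/(2*Real.pi) -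
              (θ^2/(2*Real.pi)) * Real.cosh (dlt (α*β)) * Real.exp (t^2/α^2 + ω^2/β^2))) /
            ((θ^2/(2*Real.pi)) * Real.cosh (dlt (α*β)) * Real.exp (t^2/α^2 + ω^2/β^2)))|
        ≤ ε * (α * β) := by
  obtain ⟨c, M₀, hM₀, hc⟩ := hSO
  have hθ2 : 0 < θ ^ 2 := by positivity
  set K : ℝ := 8 * c / θ ^ 2 + 1 with hK
  intro ε hε
  refine ⟨max (max M₀ 2) ((1 / 8 + K / 8 + (K + 1) / 2) / ε), by
    exact lt_of_lt_of_le (by norm_num) ((le_max_right M₀ 2).trans (le_max_left _ _)), ?_⟩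
  intro α β hα hβ hM
  rw [max_lt_iff, max_lt_iff, div_lt_iff₀ hε] at hM
  obtain ⟨⟨hxM, hx2⟩, hxε⟩ := hM
  set x := α * β with hx
  have hx1 : 1 < x := by linarith
  obtain ⟨hδl, hδu⟩ := dlt_bounds hx1
  set δ := dlt x with hδdef
  have hδ : 0 < δ := lt_of_lt_of_le (by positivity) hδl
  rw [div_le_iff₀ (by linarith)] at hδl
  rw [le_div_iff₀ (by linarith)] at hδu
  have hrho (k : ℕ) : rho x ^ (2 * k + 1) = Real.exp (-((2 * k + 1) * δ)) := by
    rw [rho, ← Real.exp_nat_mul, ← hδdef]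
    push_cast
    ring_nf
  have hvx := hv x hx1
  have hvpos : 0 < v x := lt_trans (div_pos hθ2 (Real.exp_pos _)) hvx
  set L := Real.log (v x) - Real.log (θ ^ 2) with hLdef
  have hδL : δ ≤ L := by
    have h := Real.log_le_log (div_pos hθ2 (Real.exp_pos _)) hvx.le
    rw [Real.log_div hθ2.ne' (Real.exp_pos _).ne', Real.log_exp] at h
    linarith
  have hvL : v x = θ ^ 2 * Real.exp L := by
    rw [hLdef, Real.exp_sub, Real.exp_log hvpos, Real.exp_log hθ2]
    field_simp
  have hCx : C x = ∑' k : ℕ, (1 / 2) * max 0 (L - (2 * k + 1) * δ) := by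
    rw [hC x hx1]
    refine tsum_congr fun k => ?_
    rw [lnplus, hrho, Real.log_div (by positivity) hθ2.ne',
      Real.log_mul hvpos.ne' (Real.exp_pos _).ne', Real.log_exp]
    congr 2
    ring
  have hmid := abs_tsum_posPart_odd_sub_le hδ hδL
  rw [← hCx] at hmid
  have hCS : 2 * θ ^ 2 * C x ≤ S x := by
    rw [← hvS x hx1, hCx, ← tsum_mul_left]
    have hterm (k : ℕ) : v x - θ ^ 2 / rho x ^ (2 * k + 1)
        = θ ^ 2 * (Real.exp L - Real.exp ((2 * k + 1) * δ)) := by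
      rw [hrho, Real.exp_neg, div_inv_eq_mul, hvL]
      ring
    refine Summable.tsum_le_tsum (fun k => ?_) ?_ ?_
    · rw [hterm]
      rcases le_total L ((2 * k + 1) * δ) with h | h
      · rw [max_eq_left (by linarith)]
        simp
      · rw [max_eq_right (by linarith)]
        refine le_trans ?_ (le_max_right _ _)
        have := sub_le_exp_sub_exp (by positivity) h
        nlinarith
    · refine summable_of_ne_finset_zero (s := Finset.range ⌈(L - δ) / (2 * δ)⌉₊) fun k hk => ?_
      rw [max_eq_left (sub_odd_mul_nonpos hδ L hk)]
      ring
    · refine summable_of_ne_finset_zero (s := Finset.range ⌈(L - δ) / (2 * δ)⌉₊) fun k hk => ?_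
      have h := sub_odd_mul_nonpos hδ L hk
      have h' := Real.exp_le_exp.mpr (show L ≤ (2 * k + 1) * δ by linarith)
      rw [hterm, max_eq_left (by nlinarith)]
  have hint : (1 / (2 * Real.pi)) * ∫ t : ℝ, ∫ ω : ℝ, (1/2) * Real.log (1 +
      (max 0 (v x / (2 * Real.pi) -
        (θ ^ 2 / (2 * Real.pi)) * Real.cosh δ * Real.exp (t ^ 2 / α ^ 2 + ω ^ 2 / β ^ 2))) /
      ((θ ^ 2 / (2 * Real.pi)) * Real.cosh δ * Real.exp (t ^ 2 / α ^ 2 + ω ^ 2 / β ^ 2)))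
      = x * (L - Real.log (Real.cosh δ)) ^ 2 / 8 := by
    have hpi := Real.pi_pos
    have hcosh := Real.cosh_pos δ
    have hpt (t ω : ℝ) : Real.log (1 +
      (max 0 (v x / (2 * Real.pi) -
        (θ ^ 2 / (2 * Real.pi)) * Real.cosh δ * Real.exp (t ^ 2 / α ^ 2 + ω ^ 2 / β ^ 2))) /
      ((θ ^ 2 / (2 * Real.pi)) * Real.cosh δ * Real.exp (t ^ 2 / α ^ 2 + ω ^ 2 / β ^ 2)))
      = max 0 (L - Real.log (Real.cosh δ) - (t ^ 2 / α ^ 2 + ω ^ 2 / β ^ 2)) := by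
      rw [log_one_add_posPart_div (by positivity) (by positivity),
        Real.log_mul (by positivity) (by positivity), Real.log_mul (by positivity) (by positivity),
        Real.log_exp, Real.log_div hvpos.ne' (by positivity),
        Real.log_div hθ2.ne' (by positivity)]
      congr 1
      ring
    simp_rw [hpt]
    rw [integral_integral_posPart_ellipse hα hβ (by linarith [log_cosh_le hδ.le])]
    field_simp
    ring
  rw [hint]
  have hlc0 := log_cosh_nonneg δ
  have hlc1 := log_cosh_le hδ.le
  set l := Real.log (Real.cosh δ)
  have hSx := (le_abs_self _).trans (hc x hxM)
  rw [abs_le] at hmid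
  have hxδ : x * δ ≤ 2 := by nlinarith
  have hδ1 : δ ≤ 1 := by nlinarith
  have hc0 : 0 ≤ c :=
    nonneg_of_mul_nonneg_left ((hSpos x hx1).le.trans hSx) (by linarith)
  have hL2 : L ^ 2 ≤ K := by
    have h : C x ≤ c / θ ^ 2 * x / 2 := by
      rw [div_mul_eq_mul_div, div_div, le_div_iff₀ (by positivity)]
      linarith
    have := sq_le_of_sq_div_le hδ hδ1 hxδ (div_nonneg hc0 hθ2.le)
      (show L ^ 2 / (8 * δ) ≤ c / θ ^ 2 * x / 2 + δ / 8 by linarith [hmid.1])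
    rw [hK, mul_div_assoc]
    exact this
  have hLK : L ≤ K + 1 := by nlinarith
  have hcmp := abs_sq_div_sub_mul_sq_le hδ (by linarith) (by linarith) hδu hxδ hlc0 hlc1 hδL hLK
  rw [abs_le] at hcmp ⊢
  constructor <;> linarith [hmid.1, hmid.2, hcmp.1, hcmp.2]
end

section
/- Let θ > 0 be fixed and let S : (1,∞) → (0,∞) satisfy S(x) = O(x) as x → ∞. For each pair α, β > 0 with αβ > 1 let v = v(αβ) > θ²·ρ^{−1} be the (unique) water level satisfying S(αβ) = ∑_{k=0}^∞ (v − θ²·ρ^{−(2k+1)})⁺. Set N(t,ω) = (θ²/(2π))·cosh δ · exp(t²/α² + ω²/β²) and ν = ν(αβ) = v(αβ)/(2π). Then S ≐ ∬_{ℝ²} (ν − N(t,ω))⁺ dt dω, i.e., the difference between the two sides is o(αβ) as αβ → ∞. -/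
open MeasureTheory

open Set

lemma integral_integral_radial {h : ℝ → ℝ} (hc : Continuous h) {L : ℝ}
    (hL : ∀ s, L ≤ s → h s = 0) :
    ∫ a : ℝ, ∫ b : ℝ, h (a ^ 2 + b ^ 2) = Real.pi * ∫ s in Ioi (0 : ℝ), h s := by
  have hint : Integrable (fun p : ℝ × ℝ => h (p.1 ^ 2 + p.2 ^ 2)) := by
    refine Continuous.integrable_of_hasCompactSupport (by fun_prop) ?_
    refine HasCompactSupport.intro (isCompact_closedBall (0 : ℝ × ℝ) (|L| + 1)) fun p hp => hL _ ?_
    rw [mem_closedBall_zero_iff, Prod.norm_def, not_le, lt_max_iff] at hp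
    have h1 := le_abs_self L
    have h2 := abs_nonneg L
    rcases hp with hp | hp <;> rw [Real.norm_eq_abs] at hp
    · nlinarith [sq_abs p.1, sq_nonneg p.2]
    · nlinarith [sq_abs p.2, sq_nonneg p.1]
  have hsq : ∫ r in Ioi (0 : ℝ), r * h (r ^ 2) = (1 / 2) * ∫ s in Ioi (0 : ℝ), h s := by
    rw [← integral_comp_rpow_Ioi_of_pos (g := h) (p := 2) two_pos, ← integral_const_mul]
    refine setIntegral_congr_fun measurableSet_Ioi fun r _ => ?_
    norm_num
    ring
  calc ∫ a : ℝ, ∫ b : ℝ, h (a ^ 2 + b ^ 2)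
      = ∫ p : ℝ × ℝ, h (p.1 ^ 2 + p.2 ^ 2) := (integral_prod _ hint).symm
    _ = ∫ p in polarCoord.target, p.1 * h (p.1 ^ 2) * 1 := by
      rw [← integral_comp_polarCoord_symm]
      refine setIntegral_congr_fun polarCoord.open_target.measurableSet fun p _ => ?_
      have : (p.1 * Real.cos p.2) ^ 2 + (p.1 * Real.sin p.2) ^ 2 = p.1 ^ 2 := by
        linear_combination p.1 ^ 2 * Real.sin_sq_add_cos_sq p.2
      simp [polarCoord_symm_apply, this]
    _ = (∫ r in Ioi (0 : ℝ), r * h (r ^ 2)) * ∫ _ in Ioo (-Real.pi) Real.pi, (1 : ℝ) := by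
      rw [polarCoord_target, Measure.volume_eq_prod,
        setIntegral_prod_mul (fun r : ℝ => r * h (r ^ 2)) (fun _ : ℝ => (1 : ℝ))]
    _ = Real.pi * ∫ s in Ioi (0 : ℝ), h s := by
      rw [hsq]
      simp [Real.pi_pos.le]
      ring

lemma integral_integral_elliptic {h : ℝ → ℝ} (hc : Continuous h) {L : ℝ}
    (hL : ∀ s, L ≤ s → h s = 0) {α β : ℝ} (hα : 0 < α) (hβ : 0 < β) :
    ∫ t : ℝ, ∫ ω : ℝ, h (t ^ 2 / α ^ 2 + ω ^ 2 / β ^ 2) =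
      α * β * (Real.pi * ∫ s in Ioi (0 : ℝ), h s) := by
  rw [← integral_integral_radial hc hL]
  simp_rw [← div_pow]
  have hω (t : ℝ) : ∫ ω : ℝ, h ((t / α) ^ 2 + (ω / β) ^ 2) =
      β * ∫ b : ℝ, h ((t / α) ^ 2 + b ^ 2) := by
    rw [Measure.integral_comp_div (fun b => h ((t / α) ^ 2 + b ^ 2)), abs_of_pos hβ, smul_eq_mul]
  simp_rw [hω]
  rw [integral_const_mul, Measure.integral_comp_div (fun a => ∫ b : ℝ, h (a ^ 2 + b ^ 2)),
    abs_of_pos hα, smul_eq_mul]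
  ring

/-- Comparison of a sum interlaced with the samples of an antitone function with its integral. -/
lemma abs_sum_sub_integral_le {g : ℝ → ℝ} (hg : Antitone g) {η : ℝ} (hη : 0 < η)
    {f : ℕ → ℝ} (hfl : ∀ k : ℕ, g (η * (k + 1 : ℕ)) ≤ f k) (hfu : ∀ k : ℕ, f k ≤ g (η * k))
    {N : ℕ} (hN : g (η * N) = 0) :
    |η * ∑ k ∈ Finset.range N, f k - ∫ s in (0 : ℝ)..η * N, g s| ≤ η * g 0 := by
  have hga : AntitoneOn (fun y => g (η * y)) (Icc (0 : ℝ) (0 + (N : ℝ))) :=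
    fun a _ b _ hab => hg (by gcongr)
  have h1 := hga.integral_le_sum
  have h2 := hga.sum_le_integral
  simp only [zero_add] at h1 h2
  have hsub : ∫ s in (0 : ℝ)..η * N, g s = η * ∫ y in (0 : ℝ)..N, g (η * y) := by
    rw [intervalIntegral.integral_comp_mul_left _ hη.ne', smul_eq_mul, mul_zero,
      mul_inv_cancel_left₀ hη.ne']
  have htel : ∑ k ∈ Finset.range N, g (η * k) = ∑ k ∈ Finset.range N, g (η * (k + 1 : ℕ)) + g 0 := by
    have := Finset.sum_range_succ (fun k : ℕ => g (η * k)) N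
    rw [Finset.sum_range_succ'] at this
    simp only [Nat.cast_zero, mul_zero, hN] at this
    linarith
  have hl := Finset.sum_le_sum fun k (_ : k ∈ Finset.range N) => hfl k
  have hu := Finset.sum_le_sum fun k (_ : k ∈ Finset.range N) => hfu k
  rw [hsub, ← mul_sub, abs_mul, abs_of_pos hη]
  gcongr
  rw [abs_le]
  constructor <;> linarith

lemma one_div_add_one_le_dlt {x : ℝ} (hx : 1 < x) : 1 / (x + 1) ≤ dlt x := by
  have h := Real.one_sub_inv_le_log_of_pos (x := (x + 1) / (x - 1))
    (div_pos (by linarith) (by linarith))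
  have : 1 - ((x + 1) / (x - 1))⁻¹ = 2 * (1 / (x + 1)) := by
    have : x + 1 ≠ 0 := by linarith
    rw [inv_div]
    field_simp
    ring
  unfold dlt
  linarith

lemma dlt_le_one_div_sub_one {x : ℝ} (hx : 1 < x) : dlt x ≤ 1 / (x - 1) := by
  have h := Real.log_le_sub_one_of_pos (x := (x + 1) / (x - 1))
    (div_pos (by linarith) (by linarith))
  have : (x + 1) / (x - 1) - 1 = 2 * (1 / (x - 1)) := by
    have : x - 1 ≠ 0 := by linarith
    field_simp
    ring
  unfold dlt
  linarith

/-- The waterfilling profile `s ↦ (w - c eˢ)⁺`. -/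
noncomputable def waterProfile (w c s : ℝ) : ℝ := max 0 (w - c * Real.exp s)

lemma continuous_waterProfile (w c : ℝ) : Continuous (waterProfile w c) := by
  unfold waterProfile
  fun_prop

lemma antitone_waterProfile (w : ℝ) {c : ℝ} (hc : 0 ≤ c) : Antitone (waterProfile w c) := by
  intro a b hab
  unfold waterProfile
  gcongr

lemma waterProfile_eq_zero {w c s : ℝ} (hc : 0 < c) (hs : w / c ≤ s) : waterProfile w c s = 0 := by
  refine max_eq_left ?_
  rw [div_le_iff₀ hc] at hs
  nlinarith [Real.add_one_le_exp s]

lemma setIntegral_Ioi_eq_intervalIntegral {g : ℝ → ℝ} {L : ℝ} (hL : 0 ≤ L)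
    (hg : ∀ s, L ≤ s → g s = 0) : ∫ s in Ioi (0 : ℝ), g s = ∫ s in (0 : ℝ)..L, g s := by
  rw [intervalIntegral.integral_of_le hL]
  refine setIntegral_eq_of_subset_of_forall_sdiff_eq_zero measurableSet_Ioi
    (fun s hs => hs.1) fun s hs => hg s ?_
  by_contra! h
  exact hs.2 ⟨hs.1, h.le⟩

/-- Comparison of the discrete waterfilling sum with noise levels `a e^{(2k+1)d}` with the
integral of the waterfilling profile. -/
lemma abs_tsum_sub_integral_waterProfile_le {a d w : ℝ} (ha : 0 < a) (hd : 0 < d) (hw : 0 ≤ w) :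
    |2 * d * ∑' k : ℕ, max 0 (w - a / Real.exp (-d) ^ (2 * k + 1)) -
      ∫ s in Ioi (0 : ℝ), waterProfile w (a * Real.cosh d) s| ≤ 2 * d * w := by
  set c := a * Real.cosh d with hcdef
  have hc : 0 < c := mul_pos ha (Real.cosh_pos d)
  have hterm (k : ℕ) : a / Real.exp (-d) ^ (2 * k + 1) = a * Real.exp ((2 * k + 1) * d) := by
    rw [← Real.exp_nat_mul, div_eq_mul_inv, ← Real.exp_neg]
    push_cast
    ring_nf
  simp_rw [hterm]
  have hcosh := Real.cosh_eq d
  have hexp : Real.exp (-d) ≤ Real.exp d := Real.exp_le_exp.2 (by linarith)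
  have hu (k : ℕ) : max 0 (w - a * Real.exp ((2 * k + 1) * d)) ≤ waterProfile w c (2 * d * k) := by
    unfold waterProfile
    rw [show ((2 * k + 1) * d : ℝ) = d + 2 * d * k by ring, Real.exp_add, ← mul_assoc]
    gcongr
    rw [hcdef]
    gcongr
    linarith
  have hl (k : ℕ) : waterProfile w c (2 * d * (k + 1 : ℕ)) ≤
      max 0 (w - a * Real.exp ((2 * k + 1) * d)) := by
    unfold waterProfile
    rw [show ((2 * k + 1) * d : ℝ) = -d + 2 * d * (k + 1 : ℕ) by push_cast; ring, Real.exp_add,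
      ← mul_assoc]
    gcongr
    rw [hcdef]
    gcongr
    linarith
  obtain ⟨N, hN⟩ := exists_nat_ge (w / c / (2 * d))
  rw [div_le_iff₀' (by positivity)] at hN
  have hzero (s : ℝ) (hs : 2 * d * N ≤ s) : waterProfile w c s = 0 :=
    waterProfile_eq_zero hc (hN.trans hs)
  rw [setIntegral_Ioi_eq_intervalIntegral (by positivity) hzero, tsum_eq_sum (s := Finset.range N)]
  · refine (abs_sum_sub_integral_le (antitone_waterProfile w hc.le) (by positivity) hl hu
      (hzero _ le_rfl)).trans ?_
    gcongr
    refine max_le hw ?_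
    simpa using hc.le
  · intro k hk
    refine le_antisymm ((hu k).trans_eq (hzero _ ?_)) (le_max_left _ _)
    have : N ≤ k := by simpa using hk
    gcongr

lemma sub_le_integral_waterProfile {w c : ℝ} (hc : 0 < c) :
    w - c * Real.exp 1 ≤ ∫ s in Ioi (0 : ℝ), waterProfile w c s := by
  have hL : (1 : ℝ) ≤ max 1 (w / c) := le_max_left _ _
  rw [setIntegral_Ioi_eq_intervalIntegral (zero_le_one.trans hL) fun s hs =>
    waterProfile_eq_zero hc ((le_max_right _ _).trans hs)]
  have hi (p q : ℝ) : IntervalIntegrable (waterProfile w c) volume p q :=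
    (continuous_waterProfile w c).intervalIntegrable p q
  calc w - c * Real.exp 1 = ∫ _ in (0 : ℝ)..1, (w - c * Real.exp 1) := by simp
    _ ≤ ∫ s in (0 : ℝ)..1, waterProfile w c s := by
      refine intervalIntegral.integral_mono_on zero_le_one (by simp) (hi _ _) fun s hs => ?_
      refine le_trans ?_ (le_max_right _ _)
      gcongr
      exact hs.2
    _ ≤ ∫ s in (0 : ℝ)..max 1 (w / c), waterProfile w c s := by
      refine intervalIntegral.integral_mono_interval le_rfl zero_le_one hL ?_ (hi _ _)
      exact Filter.Eventually.of_forall fun s => le_max_left _ _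

lemma integral_integral_waterProfile {w c : ℝ} (hc : 0 < c) {α β : ℝ} (hα : 0 < α) (hβ : 0 < β) :
    ∫ t : ℝ, ∫ ω : ℝ, max 0 (w / (2 * Real.pi) -
        c / (2 * Real.pi) * Real.exp (t ^ 2 / α ^ 2 + ω ^ 2 / β ^ 2)) =
      α * β / 2 * ∫ s in Ioi (0 : ℝ), waterProfile w c s := by
  have hπ := Real.pi_pos
  have hscale (s : ℝ) : max 0 (w / (2 * Real.pi) - c / (2 * Real.pi) * Real.exp s) =
      (2 * Real.pi)⁻¹ * waterProfile w c s := by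
    rw [waterProfile, mul_max_of_nonneg _ _ (by positivity)]
    ring_nf
  simp_rw [hscale]
  rw [integral_integral_elliptic (h := fun s => (2 * Real.pi)⁻¹ * waterProfile w c s)
    ((continuous_waterProfile w c).const_mul _)
    (fun s hs => by rw [waterProfile_eq_zero hc hs, mul_zero]) hα hβ, integral_const_mul]
  field_simp

/-- Input-energy half of the waterfilling theorem for the heat channel:
`S ≐ ∬ (ν − N(t,ω))⁺ dt dω` as `αβ → ∞`. -/
theorem heat_channel_energy_waterfilling
    (θ : ℝ) (hθ : 0 < θ)
    (S : ℝ → ℝ) (hSpos : ∀ x, 1 < x → 0 < S x)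
    (hSO : ∃ c M : ℝ, 1 < M ∧ ∀ x, M < x → |S x| ≤ c * x)
    (v : ℝ → ℝ)
    (hv : ∀ x, 1 < x → θ^2 / rho x < v x)
    (hvS : ∀ x, 1 < x → (∑' k : ℕ, max 0 (v x - θ^2 / (rho x)^(2*k+1))) = S x) :
    ∀ ε > 0, ∃ M, 1 < M ∧ ∀ α β : ℝ, 0 < α → 0 < β → M < α * β →
      |S (α * β) -
        ∫ t : ℝ, ∫ ω : ℝ,
          max 0 (v (α*β)/(2*Real.pi) -
            (θ^2/(2*Real.pi)) * Real.cosh (dlt (α*β)) * Real.exp (t^2/α^2 + ω^2/β^2))|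
        ≤ ε * (α * β) := by
  obtain ⟨C, M₀, -, hC⟩ := hSO
  intro ε hε
  set V := 2 * (θ ^ 2 * Real.exp 1 * Real.exp 1 + 4 * C) with hV
  refine ⟨max (max 5 M₀) ((2 * V + 2 * C) / ε), ?_, ?_⟩
  · exact lt_max_of_lt_left (lt_max_of_lt_left (by norm_num))
  intro α β hα hβ hM
  simp only [max_lt_iff] at hM
  obtain ⟨⟨h5, hxM⟩, hxε⟩ := hM
  rw [div_lt_iff₀ hε] at hxε
  set x := α * β
  have hx1 : 1 < x := by linarith
  set d := dlt x
  have hdl : 1 / (x + 1) ≤ d := one_div_add_one_le_dlt hx1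
  have hdu : d ≤ 1 / (x - 1) := dlt_le_one_div_sub_one hx1
  have hdpos : 0 < d := lt_of_lt_of_le (by positivity) hdl
  rw [div_le_iff₀ (by linarith)] at hdl
  rw [le_div_iff₀ (by linarith)] at hdu
  have hd4 : d ≤ 1 / 4 := by nlinarith
  have hθ2 : 0 < θ ^ 2 := by positivity
  have hvpos : 0 < v x := lt_trans (div_pos hθ2 (Real.exp_pos _)) (hv x hx1)
  have hSx : S x ≤ C * x := (le_abs_self _).trans (hC x hxM)
  have hCpos : 0 < C := by
    by_contra! h
    nlinarith [hSpos x hx1]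
  have hc : 0 < θ ^ 2 * Real.cosh d := mul_pos hθ2 (Real.cosh_pos d)
  have hcmp := abs_tsum_sub_integral_waterProfile_le hθ2 hdpos hvpos.le
  have hsum : ∑' k : ℕ, max 0 (v x - θ ^ 2 / Real.exp (-d) ^ (2 * k + 1)) = S x := hvS x hx1
  have hlow := sub_le_integral_waterProfile (w := v x) hc
  have hI := integral_integral_waterProfile (w := v x) hc hα hβ
  rw [hsum] at hcmp
  simp only [mul_div_right_comm (θ ^ 2)] at hI
  rw [hI]
  change |S x - x / 2 * _| ≤ _
  set J := ∫ s in Ioi (0 : ℝ), waterProfile (v x) (θ ^ 2 * Real.cosh d) s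
  have hcosh : Real.cosh d ≤ Real.exp 1 := by
    have h1 := Real.cosh_eq d
    have h2 : Real.exp (-d) ≤ Real.exp 1 := Real.exp_le_exp.2 (by linarith)
    have h3 : Real.exp d ≤ Real.exp 1 := Real.exp_le_exp.2 (by linarith)
    linarith
  have hcE : θ ^ 2 * Real.cosh d * Real.exp 1 ≤ θ ^ 2 * Real.exp 1 * Real.exp 1 := by gcongr
  have hJ := (abs_le.1 hcmp).1
  have hdx : d * x ≤ 2 := by nlinarith
  have hdS : 2 * d * S x ≤ 4 * C := by nlinarith
  have hvV : v x ≤ V := by nlinarith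
  have he : |1 - d * x| ≤ d := by
    rw [abs_le]
    constructor <;> linarith
  calc |S x - x / 2 * J| = |S x * (1 - d * x) + x / 2 * (2 * d * S x - J)| := by ring_nf
    _ ≤ S x * |1 - d * x| + x / 2 * |2 * d * S x - J| := by
      refine (abs_add_le _ _).trans_eq ?_
      rw [abs_mul, abs_mul, abs_of_pos (hSpos x hx1), abs_of_pos (by linarith : 0 < x / 2)]
    _ ≤ S x * d + x / 2 * (2 * d * v x) := by
      have := hSpos x hx1
      gcongr
    _ ≤ ε * x := by nlinarith
end

section
/- Let σ > 0 be fixed and set E(αβ) = ∑_{k=0}^∞ σ²·ρ^{2k+1}. Let D : (1,∞) → (0,∞) satisfy D(x) = Ω(x) as x → ∞ (that is, liminf_{x→∞} D(x)/x > 0) and 0 < D(αβ) < E(αβ) for all αβ > 1. For each pair α, β > 0 with αβ > 1 let w = w(αβ) ∈ (0, σ²·ρ) be the (unique) level satisfying D(αβ) = ∑_{k=0}^∞ min{ w, σ²·ρ^{2k+1} }. Set Φ(t,ω) = (σ²/(2π))·(1/cosh δ)·exp(−t²/α² − ω²/β²) and λ = λ(αβ) = w(αβ)/(2π). Then D ≐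 ∬_{ℝ²} min{ λ, Φ(t,ω) } dt dω, i.e., the difference between the two sides is o(αβ) as αβ → ∞. -/
open MeasureTheory

/-- The midpoint sum with unit step of a nonincreasing nonnegative function on `[0, ∞)`
differs from the integral by at most a bound of the function. -/
theorem abs_tsum_midpoint_sub_integral_le {g : ℝ → ℝ} {C : ℝ} (hg : AntitoneOn g (Set.Ici 0))
    (hgi : IntegrableOn g (Set.Ioi 0)) (h0 : ∀ y, 0 ≤ g y) (hC : ∀ y, 0 ≤ y → g y ≤ C)
    (hs : Summable fun k : ℕ => g (1 / 2 + k)) :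
    |(∑' k : ℕ, g (1 / 2 + k)) - ∫ y in Set.Ioi 0, g y| ≤ C := by
  have hgi' : IntegrableOn g (Set.Ioi (1 / 2)) :=
    hgi.mono_set (Set.Ioi_subset_Ioi (by norm_num))
  have hanti (n : ℕ) : AntitoneOn g (Set.Icc (1 / 2) (1 / 2 + n)) :=
    hg.mono fun y hy => by
      have := hy.1
      simp only [Set.mem_Ici]
      linarith
  have hlim : Filter.Tendsto (fun n : ℕ => ∫ y in (1 / 2 : ℝ)..(1 / 2 + n), g y) Filter.atTop
      (nhds (∫ y in Set.Ioi (1 / 2), g y)) :=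
    intervalIntegral_tendsto_integral_Ioi _ hgi'
      (Filter.tendsto_atTop_add_const_left _ _ tendsto_natCast_atTop_atTop)
  have hlow : ∫ y in Set.Ioi (1 / 2), g y ≤ ∑' k : ℕ, g (1 / 2 + k) :=
    le_of_tendsto_of_tendsto' hlim hs.hasSum.tendsto_sum_nat
      fun n => (hanti n).integral_le_sum
  have hup : ∑' k : ℕ, g (1 / 2 + k) ≤ (∫ y in Set.Ioi (1 / 2), g y) + g (1 / 2) := by
    refine le_of_tendsto_of_tendsto'
      ((Filter.tendsto_add_atTop_iff_nat 1).2 hs.hasSum.tendsto_sum_nat)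
      (hlim.add_const (g (1 / 2))) fun n => ?_
    rw [Finset.sum_range_succ']
    simpa using (hanti n).sum_le_integral
  have hsplit : ∫ y in Set.Ioi 0, g y =
      (∫ y in Set.Ioc 0 (1 / 2), g y) + ∫ y in Set.Ioi (1 / 2), g y := by
    rw [← setIntegral_union (Set.Ioc_disjoint_Ioi le_rfl) measurableSet_Ioi
      (hgi.mono_set Set.Ioc_subset_Ioi_self) hgi',
      Set.Ioc_union_Ioi_eq_Ioi (by norm_num)]
  have hfirst0 : 0 ≤ ∫ y in Set.Ioc (0 : ℝ) (1 / 2), g y :=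
    setIntegral_nonneg measurableSet_Ioc fun y _ => h0 y
  have hfirst : ∫ y in Set.Ioc (0 : ℝ) (1 / 2), g y ≤ C / 2 := by
    calc ∫ y in Set.Ioc (0 : ℝ) (1 / 2), g y ≤ ∫ _ in Set.Ioc (0 : ℝ) (1 / 2), C :=
          setIntegral_mono_on (hgi.mono_set Set.Ioc_subset_Ioi_self)
            (integrableOn_const (by simp)) measurableSet_Ioc fun y hy => hC y hy.1.le
      _ = C / 2 := by
          simp
          ring
  have hhalf := hC (1 / 2) (by norm_num)
  have hhalf0 := h0 (1 / 2)
  rw [abs_le]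
  constructor <;> linarith

/-- A truncated exponential is integrable on the half-line. -/
theorem integrableOn_min_mul_exp_neg {a b : ℝ} (ha : 0 ≤ a) (hb : 0 ≤ b) :
    IntegrableOn (fun v => min a (b * Real.exp (-v))) (Set.Ioi 0) := by
  have h : IntegrableOn (fun v : ℝ => b * Real.exp (-v)) (Set.Ioi 0) :=
    (integrableOn_exp_neg_Ioi 0).const_mul b
  refine h.mono' (by fun_prop) (Filter.Eventually.of_forall fun v => ?_)
  rw [Real.norm_of_nonneg (le_min ha (by positivity))]
  exact min_le_right _ _

/-- The integral over the plane of a truncated Gaussian, as an integral over the half-line. -/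
theorem integral_integral_min_mul_exp {a b α β : ℝ} (ha : 0 ≤ a) (hb : 0 ≤ b)
    (hα : 0 < α) (hβ : 0 < β) :
    ∫ t : ℝ, ∫ ω : ℝ, min a (b * Real.exp (-(t ^ 2 / α ^ 2) - ω ^ 2 / β ^ 2)) =
      α * β * Real.pi * ∫ v in Set.Ioi 0, min a (b * Real.exp (-v)) := by
  set G : ℝ → ℝ := fun v => min a (b * Real.exp (-v)) with hG
  have hprod : Integrable (fun p : ℝ × ℝ => G (p.1 ^ 2 + p.2 ^ 2)) := by
    have hgauss : Integrable (fun s : ℝ => Real.exp (-s ^ 2)) := by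
      simpa using integrable_exp_neg_mul_sq one_pos
    have h : Integrable (fun p : ℝ × ℝ => b * (Real.exp (-p.1 ^ 2) * Real.exp (-p.2 ^ 2))) :=
      (hgauss.mul_prod hgauss).const_mul b
    refine h.mono' (by fun_prop) (Filter.Eventually.of_forall fun p => ?_)
    rw [Real.norm_of_nonneg (le_min ha (by positivity)), ← Real.exp_add, ← neg_add]
    exact min_le_right _ _
  have hradial : ∫ r in Set.Ioi (0 : ℝ), r * G (r ^ 2) = 1 / 2 * ∫ v in Set.Ioi 0, G v := by
    rw [← integral_comp_rpow_Ioi_of_pos (g := G) two_pos, ← integral_const_mul]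
    refine setIntegral_congr_fun measurableSet_Ioi fun r _ => ?_
    norm_num
    ring
  have hpolar : ∫ p : ℝ × ℝ, G (p.1 ^ 2 + p.2 ^ 2) = Real.pi * ∫ v in Set.Ioi 0, G v := by
    rw [← integral_comp_polarCoord_symm]
    have heq (p : ℝ × ℝ) : p.1 • G ((polarCoord.symm p).1 ^ 2 + (polarCoord.symm p).2 ^ 2) =
        (p.1 * G (p.1 ^ 2)) * 1 := by
      have : (p.1 * Real.cos p.2) ^ 2 + (p.1 * Real.sin p.2) ^ 2 = p.1 ^ 2 := by
        rw [mul_pow, mul_pow, ← mul_add, Real.cos_sq_add_sin_sq, mul_one]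
      simp [polarCoord_symm_apply, this]
    simp_rw [heq]
    rw [polarCoord_target, Measure.volume_eq_prod,
      setIntegral_prod_mul (fun r : ℝ => r * G (r ^ 2)) (fun _ : ℝ => (1 : ℝ)), hradial]
    have : ∫ _ in Set.Ioo (-Real.pi) Real.pi, (1 : ℝ) = 2 * Real.pi := by
      simp [Real.pi_pos.le]
      ring
    rw [this]
    ring
  have hinner (t : ℝ) : ∫ ω : ℝ, min a (b * Real.exp (-(t ^ 2 / α ^ 2) - ω ^ 2 / β ^ 2)) =
      β * ∫ u : ℝ, G ((t / α) ^ 2 + u ^ 2) := by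
    rw [← abs_of_pos hβ, ← smul_eq_mul,
      ← Measure.integral_comp_div (fun u => G ((t / α) ^ 2 + u ^ 2)), abs_of_pos hβ]
    refine integral_congr_ae (Filter.Eventually.of_forall fun ω => ?_)
    simp only [hG, div_pow]
    ring_nf
  simp_rw [hinner]
  rw [integral_const_mul,
    Measure.integral_comp_div (fun s => ∫ u : ℝ, G (s ^ 2 + u ^ 2)) α, abs_of_pos hα,
    ← integral_prod _ hprod, ← Measure.volume_eq_prod, hpolar, smul_eq_mul]
  ring

theorem dlt_pos {x : ℝ} (hx : 1 < x) : 0 < dlt x := by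
  have : 0 < Real.log ((x + 1) / (x - 1)) :=
    Real.log_pos ((one_lt_div (by linarith)).2 (by linarith))
  unfold dlt
  positivity

theorem exp_two_mul_dlt {x : ℝ} (hx : 1 < x) :
    Real.exp (2 * dlt x) = (x + 1) / (x - 1) := by
  have h : 0 < (x + 1) / (x - 1) := div_pos (by linarith) (by linarith)
  rw [dlt, ← mul_assoc]
  norm_num
  exact Real.exp_log h

/-- The defining relation `coth δ = x`. -/
theorem cosh_dlt {x : ℝ} (hx : 1 < x) :
    Real.cosh (dlt x) = x * Real.sinh (dlt x) := by
  have h := exp_two_mul_dlt hx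
  rw [eq_div_iff (by linarith), two_mul, Real.exp_add] at h
  have hne := Real.exp_ne_zero (dlt x)
  rw [Real.cosh_eq, Real.sinh_eq, Real.exp_neg]
  field_simp
  linarith

theorem one_sub_inv_cosh_dlt_le {x : ℝ} (hx : 1 < x) :
    1 - (Real.cosh (dlt x))⁻¹ ≤ 1 / x := by
  have hx0 : 0 < x := by linarith
  have hs : 0 ≤ Real.sinh (dlt x) := (Real.sinh_pos_iff.2 (dlt_pos hx)).le
  have hc := cosh_dlt hx
  have hsq := Real.cosh_sq (dlt x)
  have hc1 := Real.one_le_cosh (dlt x)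
  have hle : Real.cosh (dlt x) - 1 ≤ Real.sinh (dlt x) := by nlinarith
  have h : 1 - (Real.cosh (dlt x))⁻¹ = (Real.cosh (dlt x) - 1) / Real.cosh (dlt x) := by
    field_simp
  rw [h, div_le_div_iff₀ (by linarith) hx0]
  nlinarith

/-- `1 / δ` approximates `x = coth δ` up to a bounded error. -/
theorem inv_dlt_bounds {x : ℝ} (hx : 1 < x) : x - 1 ≤ 1 / dlt x ∧ 1 / dlt x ≤ x + 1 := by
  have h1 : 0 < x - 1 := by linarith
  have h2 : 0 < x + 1 := by linarith
  have hd := dlt_pos hx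
  have he := exp_two_mul_dlt hx
  have hup := Real.add_one_le_exp (2 * dlt x)
  have hlow := Real.add_one_le_exp (-(2 * dlt x))
  rw [Real.exp_neg, he, inv_div, le_div_iff₀ h2] at hlow
  rw [he, le_div_iff₀ h1] at hup
  constructor
  · rw [le_div_iff₀ hd]
    linarith
  · rw [div_le_iff₀ hd]
    linarith

/-- The reverse water-filling sum against the integral of a truncated exponential. -/
theorem abs_tsum_min_sub_integral_le {x c a : ℝ} (hx : 1 < x) (hc : 0 ≤ c) (ha : 0 ≤ a) :
    |(∑' k : ℕ, min a (c * rho x ^ (2 * k + 1))) -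
      1 / dlt x / 2 * ∫ v in Set.Ioi 0, min a (c * Real.exp (-v))| ≤ c := by
  have hd := dlt_pos hx
  have h2d : 0 < 2 * dlt x := by linarith
  set g : ℝ → ℝ := fun y => min a (c * Real.exp (-(2 * dlt x * y))) with hg
  have hterm (k : ℕ) : min a (c * rho x ^ (2 * k + 1)) = g (1 / 2 + k) := by
    simp only [hg, rho, ← Real.exp_nat_mul]
    push_cast
    ring_nf
  have hgi : IntegrableOn g (Set.Ioi 0) := by
    have := (integrableOn_Ioi_comp_mul_left_iff
      (fun v => min a (c * Real.exp (-v))) 0 h2d).2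
      (by simpa using integrableOn_min_mul_exp_neg ha hc)
    exact this
  have hI : ∫ y in Set.Ioi 0, g y =
      1 / dlt x / 2 * ∫ v in Set.Ioi 0, min a (c * Real.exp (-v)) := by
    have := integral_comp_mul_left_Ioi (fun v => min a (c * Real.exp (-v))) 0 h2d
    rw [mul_zero, smul_eq_mul] at this
    rw [this]
    congr 1
    field_simp
  have hmono : AntitoneOn g (Set.Ici 0) := by
    intro y _ z _ hyz
    simp only [hg]
    gcongr
  have h0 (y : ℝ) : 0 ≤ g y := le_min ha (by positivity)
  have hC (y : ℝ) (hy : 0 ≤ y) : g y ≤ c := by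
    refine (min_le_right _ _).trans (mul_le_of_le_one_right hc ?_)
    rw [Real.exp_le_one_iff]
    have := mul_nonneg h2d.le hy
    linarith
  have hs : Summable fun k : ℕ => g (1 / 2 + k) := by
    have hρ0 : 0 ≤ rho x := (Real.exp_pos _).le
    have hρ1 : rho x < 1 := Real.exp_lt_one_iff.mpr (by linarith)
    have hgeom : Summable fun k : ℕ => c * rho x ^ (2 * k + 1) := by
      have := (summable_geometric_of_lt_one (sq_nonneg (rho x))
        (pow_lt_one₀ hρ0 hρ1 two_ne_zero)).mul_left (c * rho x)
      refine this.congr fun k => ?_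
      rw [← pow_mul]
      ring
    refine hgeom.of_nonneg_of_le (fun k => h0 _) fun k => ?_
    rw [← hterm]
    exact min_le_right _ _
  simp_rw [hterm]
  rw [← hI]
  exact abs_tsum_midpoint_sub_integral_le hmono hgi h0 hC hs

theorem integral_min_mul_exp_neg_le {a b : ℝ} (ha : 0 ≤ a) (hb : 0 ≤ b) :
    ∫ v in Set.Ioi 0, min a (b * Real.exp (-v)) ≤ b := by
  calc ∫ v in Set.Ioi 0, min a (b * Real.exp (-v)) ≤ ∫ v in Set.Ioi 0, b * Real.exp (-v) :=
        setIntegral_mono (integrableOn_min_mul_exp_neg ha hb)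
          ((integrableOn_exp_neg_Ioi 0).const_mul b) fun v => min_le_right _ _
    _ = b := by rw [integral_const_mul, integral_exp_neg_Ioi_zero, mul_one]

/-- The integral of a truncated exponential is nondecreasing and 1-Lipschitz in the amplitude. -/
theorem integral_min_mul_exp_neg_sub_mem {a b c : ℝ} (ha : 0 ≤ a) (hb : 0 ≤ b) (hbc : b ≤ c) :
    (∫ v in Set.Ioi 0, min a (c * Real.exp (-v))) -
      (∫ v in Set.Ioi 0, min a (b * Real.exp (-v))) ∈ Set.Icc 0 (c - b) := by
  have hic := integrableOn_min_mul_exp_neg ha (hb.trans hbc)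
  have hib := integrableOn_min_mul_exp_neg ha hb
  constructor
  · refine sub_nonneg.2 (setIntegral_mono hib hic fun v => ?_)
    dsimp only
    gcongr
  · calc _ = ∫ v in Set.Ioi 0, (min a (c * Real.exp (-v)) - min a (b * Real.exp (-v))) :=
          (integral_sub hic hib).symm
      _ ≤ ∫ v in Set.Ioi 0, (c - b) * Real.exp (-v) := by
          refine setIntegral_mono (hic.sub hib)
            ((integrableOn_exp_neg_Ioi 0).const_mul (c - b)) fun v => ?_
          have h : b * Real.exp (-v) ≤ c * Real.exp (-v) := by gcongr
          dsimp only
          rcases min_cases a (b * Real.exp (-v)) with ⟨h1, h2⟩ | ⟨h1, h2⟩ <;>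
            rw [h1]
          · linarith [min_le_left a (c * Real.exp (-v))]
          · linarith [min_le_right a (c * Real.exp (-v))]
      _ = c - b := by rw [integral_const_mul, integral_exp_neg_Ioi_zero, mul_one]

/-- Distortion half of the reverse waterfilling theorem for the nonstationary source:
`D ≐ ∬ min{λ, Φ(t,ω)} dt dω` as `αβ → ∞`. -/
theorem source_distortion_reverse_waterfilling
    (σ : ℝ) (hσ : 0 < σ)
    (D : ℝ → ℝ) (hDpos : ∀ x, 1 < x → 0 < D x)
    (hDΩ : ∃ c M : ℝ, 0 < c ∧ 1 < M ∧ ∀ x, M < x → c * x ≤ D x)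
    (hDE : ∀ x, 1 < x → D x < ∑' k : ℕ, σ^2 * (rho x)^(2*k+1))
    (w : ℝ → ℝ)
    (hw : ∀ x, 1 < x → 0 < w x ∧ w x < σ^2 * rho x)
    (hwD : ∀ x, 1 < x → (∑' k : ℕ, min (w x) (σ^2 * (rho x)^(2*k+1))) = D x) :
    ∀ ε > 0, ∃ M, 1 < M ∧ ∀ α β : ℝ, 0 < α → 0 < β → M < α * β →
      |D (α * β) -
        ∫ t : ℝ, ∫ ω : ℝ,
          min (w (α*β) / (2*Real.pi))
            ((σ^2/(2*Real.pi)) * (Real.cosh (dlt (α*β)))⁻¹ *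
              Real.exp (-(t^2/α^2) - ω^2/β^2))|
        ≤ ε * (α * β) := by
  intro ε hε
  refine ⟨max 1 (2 * σ ^ 2 / ε) + 1, by linarith [le_max_left 1 (2 * σ ^ 2 / ε)],
    fun α β hα hβ hM => ?_⟩
  have hx : 1 < α * β := by linarith [le_max_left 1 (2 * σ ^ 2 / ε)]
  have hxε : 2 * σ ^ 2 ≤ ε * (α * β) := by
    have : 2 * σ ^ 2 / ε ≤ α * β := by linarith [le_max_right 1 (2 * σ ^ 2 / ε)]
    rw [div_le_iff₀ hε] at this
    linarith
  have hwx := (hw _ hx).1.le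
  have hwD' := hwD _ hx
  have hc := sq_nonneg σ
  have hch := inv_le_one_of_one_le₀ (Real.one_le_cosh (dlt (α * β)))
  have hch0 : 0 ≤ (Real.cosh (dlt (α * β)))⁻¹ := inv_nonneg.2 (Real.cosh_pos _).le
  have hch1 := one_sub_inv_cosh_dlt_le hx
  have hsum := abs_tsum_min_sub_integral_le hx hc hwx
  obtain ⟨hl, hu⟩ := inv_dlt_bounds hx
  have hπ := Real.pi_pos
  rw [integral_integral_min_mul_exp (by positivity) (by positivity) hα hβ]
  rw [hwD'] at hsum
  generalize α * β = x at *
  generalize w x = a at *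
  set q := (Real.cosh (dlt x))⁻¹
  have hscale : x * Real.pi * ∫ v in Set.Ioi 0,
      min (a / (2 * Real.pi)) (σ ^ 2 / (2 * Real.pi) * q * Real.exp (-v)) =
      x / 2 * ∫ v in Set.Ioi 0, min a (σ ^ 2 * q * Real.exp (-v)) := by
    have h (v : ℝ) : min (a / (2 * Real.pi)) (σ ^ 2 / (2 * Real.pi) * q * Real.exp (-v)) =
        (2 * Real.pi)⁻¹ * min a (σ ^ 2 * q * Real.exp (-v)) := by
      rw [mul_min_of_nonneg _ _ (by positivity)]
      congr 1 <;> ring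
    simp_rw [h]
    rw [integral_const_mul]
    field_simp
  rw [hscale]
  have hqc : σ ^ 2 * q ≤ σ ^ 2 := mul_le_of_le_one_right hc hch
  obtain ⟨hJ0, hJ1⟩ := integral_min_mul_exp_neg_sub_mem hwx (by positivity) hqc
  have hJc := integral_min_mul_exp_neg_le hwx hc
  have hJ : 0 ≤ ∫ v in Set.Ioi 0, min a (σ ^ 2 * Real.exp (-v)) :=
    integral_nonneg fun v => le_min hwx (by positivity)
  generalize (∫ v in Set.Ioi 0, min a (σ ^ 2 * Real.exp (-v))) = J at *
  generalize (∫ v in Set.Ioi 0, min a (σ ^ 2 * q * Real.exp (-v))) = J' at *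
  generalize 1 / dlt x = d at *
  have hx0 : 0 < x := by linarith
  have hstep : |d / 2 * J - x / 2 * J| ≤ σ ^ 2 / 2 := by
    rw [← sub_mul, abs_mul, abs_of_nonneg hJ]
    have : |d / 2 - x / 2| ≤ 1 / 2 := abs_le.2 ⟨by linarith, by linarith⟩
    calc |d / 2 - x / 2| * J ≤ 1 / 2 * σ ^ 2 := by gcongr
      _ = σ ^ 2 / 2 := by ring
  have hlast : |x / 2 * J - x / 2 * J'| ≤ σ ^ 2 / 2 := by
    rw [← mul_sub, abs_of_nonneg (by positivity)]
    have : x * (1 - q) ≤ 1 := by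
      rwa [le_div_iff₀ hx0, mul_comm] at hch1
    calc x / 2 * (J - J') ≤ x / 2 * (σ ^ 2 - σ ^ 2 * q) := by gcongr
      _ = σ ^ 2 / 2 * (x * (1 - q)) := by ring
      _ ≤ σ ^ 2 / 2 := mul_le_of_le_one_right (by positivity) this
  calc |D x - x / 2 * J'| ≤ |D x - d / 2 * J| + |d / 2 * J - x / 2 * J'| := abs_sub_le _ _ _
    _ ≤ |D x - d / 2 * J| + (|d / 2 * J - x / 2 * J| + |x / 2 * J - x / 2 * J'|) := by
        gcongr
        exact abs_sub_le _ _ _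
    _ ≤ ε * x := by linarith
end

section
/- (Szegő theorem.) Let Δ ∈ (0,∞) and let g : [0,Δ] → ℝ be continuous such that the limit lim_{x→0+} g(x)/x exists (in ℝ). Let a : (1,∞) → ℝ be bounded and b : (1,∞) → [0,Δ] arbitrary, and define G(x,z) = a(x)·g(b(x)·z) for x ∈ (1,∞) and z ∈ [0,1]. Then ∑_{k=0}^∞ G(αβ, λ_k) ≐ (1/(2π)) ∬_{ℝ²} G(αβ, σ_A(t,ω)) dt dω; explicitly, for every ε > 0 there exists M > 1 such that for all α, β > 0 with αβ > M, | ∑_{k=0}^∞ a(αβ)·g(b(αβ)·ρ^{2k+1}) − (1/(2π)) ∬_{ℝ²} a(αβ)·g( b(αβ)·(1/cosh δ)·e^{−t²/α² − ω²/β²} ) dt dω | ≤ ε·αβ. -/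
open MeasureTheory

open Set Filter Topology in
/-- A continuous function on `[0, Δ]` with a right derivative quotient at `0` factors as `u * H u`
there, with `H` bounded and uniformly continuous on the whole line. -/
theorem exists_uniformContinuous_factor {Δ : ℝ} (hΔ : 0 < Δ) {g : ℝ → ℝ}
    (hg : ContinuousOn g (Icc 0 Δ)) {L : ℝ}
    (hL : Tendsto (fun x => g x / x) (𝓝[>] 0) (𝓝 L)) :
    ∃ (H : ℝ → ℝ) (K : ℝ), UniformContinuous H ∧ (∀ u, |H u| ≤ K) ∧
      ∀ u ∈ Icc 0 Δ, g u = u * H u := by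
  have hioc : 𝓝[Ioc 0 Δ] (0 : ℝ) = 𝓝[>] 0 := nhdsWithin_Ioc_eq_nhdsGT hΔ
  have hg0 : g 0 = 0 := by
    have h1 : Tendsto g (𝓝[>] 0) (𝓝 (g 0)) := by
      have := (hg 0 (left_mem_Icc.2 hΔ.le)).mono Ioc_subset_Icc_self
      rwa [ContinuousWithinAt, hioc] at this
    have h2 : Tendsto (fun x : ℝ => x) (𝓝[>] 0) (𝓝 0) := tendsto_id.mono_left nhdsWithin_le_nhds
    have h3 : Tendsto g (𝓝[>] 0) (𝓝 (L * 0)) := by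
      refine (hL.mul h2).congr' ?_
      filter_upwards [self_mem_nhdsWithin] with x hx
      have hx' : x ≠ 0 := ne_of_gt hx
      field_simp
    simpa using tendsto_nhds_unique h1 h3
  have hdiff : Icc 0 Δ \ {0} = Ioc 0 Δ := Icc_sdiff_left
  have hc : ContinuousOn (Function.update (fun u => g u / u) 0 L) (Icc 0 Δ) := by
    rw [continuousOn_update_iff, hdiff, hioc]
    refine ⟨(hg.mono Ioc_subset_Icc_self).div continuousOn_id fun x hx => hx.1.ne', fun _ => hL⟩
  have hu : UniformContinuous ((Icc 0 Δ).domRestrict (Function.update (fun u => g u / u) 0 L)) :=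
    CompactSpace.uniformContinuous_of_continuous hc.domRestrict
  obtain ⟨K, hK⟩ := isCompact_Icc.exists_bound_of_continuousOn hc
  refine ⟨_, K, hu.comp (LipschitzWith.projIcc hΔ.le).uniformContinuous,
    fun u => hK _ (projIcc 0 Δ hΔ.le u).2, fun u hu => ?_⟩
  simp only [Function.comp_apply, projIcc_of_mem hΔ.le hu, Set.domRestrict_apply]
  rcases eq_or_ne u 0 with rfl | h
  · simp [hg0]
  · rw [Function.update_of_ne h]
    field_simp

open Set Filter Topology in
/-- Tagged Riemann sums over the geometric partition of `[0, 1]` approximate the integral. -/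
theorem abs_tsum_geometric_sub_integral_le {q : ℝ} (hq0 : 0 < q) (hq1 : q < 1) {f : ℝ → ℝ}
    (hf : Continuous f) {v : ℕ → ℝ} {η : ℝ}
    (hv : ∀ k, ∀ u ∈ Icc (q ^ (k + 1)) (q ^ k), |v k - f u| ≤ η)
    (hs : Summable fun k => (q ^ k - q ^ (k + 1)) * v k) :
    |∑' k, (q ^ k - q ^ (k + 1)) * v k - ∫ u in (0 : ℝ)..1, f u| ≤ η := by
  have hη : 0 ≤ η := (abs_nonneg _).trans (hv 0 1 (by simp [hq1.le]))
  have hpow : Tendsto (fun n : ℕ => q ^ n) atTop (𝓝 0) :=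
    tendsto_pow_atTop_nhds_zero_of_lt_one hq0.le hq1
  have hint : Tendsto (fun n : ℕ => ∫ u in q ^ n..1, f u) atTop (𝓝 (∫ u in (0 : ℝ)..1, f u)) := by
    have hcont : Continuous fun s : ℝ => ∫ u in s..1, f u := by
      simp_rw [fun s : ℝ => intervalIntegral.integral_symm (μ := volume) (f := f) 1 s]
      exact (intervalIntegral.continuous_primitive
        (fun a b => hf.intervalIntegrable a b) 1).neg
    exact (hcont.tendsto 0).comp hpow
  refine le_of_tendsto ((hs.hasSum.tendsto_sum_nat.sub hint).abs) (Eventually.of_forall fun n => ?_)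
  have hsplit : ∫ u in q ^ n..1, f u = ∑ k ∈ Finset.range n, ∫ u in q ^ (k + 1)..q ^ k, f u := by
    have h := intervalIntegral.sum_integral_adjacent_intervals (f := f) (μ := volume)
      (a := fun k : ℕ => q ^ k) (n := n) fun k _ => hf.intervalIntegrable _ _
    rw [intervalIntegral.integral_symm, ← pow_zero q, ← h, ← Finset.sum_neg_distrib]
    exact Finset.sum_congr rfl fun k _ => (intervalIntegral.integral_symm _ _).symm
  rw [hsplit, ← Finset.sum_sub_distrib]
  calc |∑ k ∈ Finset.range n, ((q ^ k - q ^ (k + 1)) * v k - ∫ u in q ^ (k + 1)..q ^ k, f u)|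
      ≤ ∑ k ∈ Finset.range n, |(q ^ k - q ^ (k + 1)) * v k - ∫ u in q ^ (k + 1)..q ^ k, f u| :=
        Finset.abs_sum_le_sum_abs _ _
    _ ≤ ∑ k ∈ Finset.range n, η * (q ^ k - q ^ (k + 1)) := by
        refine Finset.sum_le_sum fun k _ => ?_
        have hle : q ^ (k + 1) ≤ q ^ k := pow_le_pow_of_le_one hq0.le hq1.le (Nat.le_succ k)
        have heq : (q ^ k - q ^ (k + 1)) * v k - ∫ u in q ^ (k + 1)..q ^ k, f u
            = ∫ u in q ^ (k + 1)..q ^ k, (v k - f u) := by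
          rw [intervalIntegral.integral_sub (by simp) (hf.intervalIntegrable _ _)]
          simp
        rw [heq]
        have h := intervalIntegral.norm_integral_le_of_norm_le_const
          (a := q ^ (k + 1)) (b := q ^ k) (C := η) (f := fun u => v k - f u) fun u hu => by
            rw [uIoc_of_le hle] at hu
            exact hv k u (Ioc_subset_Icc_self hu)
        rwa [abs_of_nonneg (sub_nonneg.2 hle)] at h
    _ = η * (1 - q ^ n) := by
        rw [← Finset.mul_sum, Finset.sum_range_sub', pow_zero]
    _ ≤ η := by nlinarith [pow_pos hq0 n]

open Set Filter Topology in
theorem integral_Ioi_mul_exp_neg_sq {H : ℝ → ℝ} {K : ℝ} (hH : Continuous H)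
    (hK : ∀ u, |H u| ≤ K) (B : ℝ) :
    ∫ y in Ioi (0 : ℝ), y * (B * Real.exp (-y ^ 2) * H (B * Real.exp (-y ^ 2)))
      = (1 / 2) * ∫ u in (0 : ℝ)..B, H u := by
  let Φ : ℝ → ℝ := fun s => ∫ u in (0 : ℝ)..s, H u
  have hΦ : ∀ s, HasDerivAt Φ (H s) s := fun s => (hH.integral_hasStrictDerivAt 0 s).hasDerivAt
  have hderiv : ∀ y : ℝ, HasDerivAt (fun y => -(1 / 2) * Φ (B * Real.exp (-y ^ 2)))
      (y * (B * Real.exp (-y ^ 2) * H (B * Real.exp (-y ^ 2)))) y := fun y => by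
    have h1 : HasDerivAt (fun y : ℝ => B * Real.exp (-y ^ 2))
        (B * (Real.exp (-y ^ 2) * (-(2 * y)))) y := by
      have := ((hasDerivAt_pow 2 y).fun_neg.exp).const_mul B
      simpa using this
    refine (((hΦ _).comp y h1).const_mul (-(1 / 2))).congr_deriv ?_
    ring
  have hgauss : Integrable fun y : ℝ => y * Real.exp (-y ^ 2) := by
    simpa using integrable_mul_exp_neg_mul_sq (b := 1) one_pos
  have hInt : Integrable fun y : ℝ => y * (B * Real.exp (-y ^ 2) * H (B * Real.exp (-y ^ 2))) := by
    refine (hgauss.mul_bdd (c := |B| * K)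
      (g := fun y => B * H (B * Real.exp (-y ^ 2))) ?_ (Eventually.of_forall fun y => ?_)).congr
      (Eventually.of_forall fun y => ?_)
    · exact (by fun_prop : Continuous fun y => B * H (B * Real.exp (-y ^ 2))).aestronglyMeasurable
    · rw [Real.norm_eq_abs, abs_mul]
      exact mul_le_mul_of_nonneg_left (hK _) (abs_nonneg B)
    · dsimp only
      ring
  have hlim : Tendsto (fun y : ℝ => -(1 / 2) * Φ (B * Real.exp (-y ^ 2))) atTop (𝓝 0) := by
    have h1 : Tendsto (fun y : ℝ => B * Real.exp (-y ^ 2)) atTop (𝓝 (B * 0)) :=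
      (Real.tendsto_exp_neg_atTop_nhds_zero.comp (tendsto_pow_atTop two_ne_zero)).const_mul B
    have h2 := ((hΦ (B * 0)).continuousAt.tendsto.comp h1).const_mul (-(1 / 2))
    simpa [Φ] using h2
  rw [integral_Ioi_of_hasDerivAt_of_tendsto (hderiv 0).continuousAt.continuousWithinAt
    (fun y _ => hderiv y) hInt.integrableOn hlim]
  simp [Φ]

open Set Filter Topology in
/-- The integral over the plane of a function of a Gaussian. -/
theorem integral_integral_gaussian {H : ℝ → ℝ} {K : ℝ} (hH : Continuous H)
    (hK : ∀ u, |H u| ≤ K) (B : ℝ) {α β : ℝ} (hα : 0 < α) (hβ : 0 < β) :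
    ∫ t : ℝ, ∫ ω : ℝ, B * Real.exp (-(t ^ 2 / α ^ 2) - ω ^ 2 / β ^ 2) *
        H (B * Real.exp (-(t ^ 2 / α ^ 2) - ω ^ 2 / β ^ 2))
      = Real.pi * (α * β) * ∫ u in (0 : ℝ)..B, H u := by
  let F : ℝ → ℝ := fun s => B * Real.exp (-s) * H (B * Real.exp (-s))
  have hscale : ∫ t : ℝ, ∫ ω : ℝ, B * Real.exp (-(t ^ 2 / α ^ 2) - ω ^ 2 / β ^ 2) *
        H (B * Real.exp (-(t ^ 2 / α ^ 2) - ω ^ 2 / β ^ 2))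
      = α * β * ∫ t : ℝ, ∫ ω : ℝ, F (t ^ 2 + ω ^ 2) := by
    have hin : ∀ t : ℝ, ∫ ω : ℝ, B * Real.exp (-(t ^ 2 / α ^ 2) - ω ^ 2 / β ^ 2) *
        H (B * Real.exp (-(t ^ 2 / α ^ 2) - ω ^ 2 / β ^ 2))
        = β * ∫ ω : ℝ, F ((t / α) ^ 2 + ω ^ 2) := fun t => by
      have h := Measure.integral_comp_div (fun ω : ℝ => F ((t / α) ^ 2 + ω ^ 2)) β
      rw [abs_of_pos hβ, smul_eq_mul] at h
      rw [← h]
      simp only [F, div_pow, neg_add, sub_eq_add_neg]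
    simp_rw [hin]
    rw [integral_const_mul,
      Measure.integral_comp_div (fun t : ℝ => ∫ ω : ℝ, F (t ^ 2 + ω ^ 2)) α,
      abs_of_pos hα, smul_eq_mul]
    ring
  have hgauss : Integrable fun y : ℝ => Real.exp (-y ^ 2) := by
    simpa using integrable_exp_neg_mul_sq (b := 1) one_pos
  have hInt : Integrable (fun p : ℝ × ℝ => F (p.1 ^ 2 + p.2 ^ 2)) (volume.prod volume) := by
    refine ((hgauss.mul_prod hgauss).mul_bdd (c := |B| * K)
      (g := fun p => B * H (B * Real.exp (-(p.1 ^ 2 + p.2 ^ 2)))) ?_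
      (Eventually.of_forall fun p => ?_)).congr (Eventually.of_forall fun p => ?_)
    · exact (by fun_prop : Continuous fun p : ℝ × ℝ =>
        B * H (B * Real.exp (-(p.1 ^ 2 + p.2 ^ 2)))).aestronglyMeasurable
    · rw [Real.norm_eq_abs, abs_mul]
      exact mul_le_mul_of_nonneg_left (hK _) (abs_nonneg B)
    · simp only [F, neg_add, Real.exp_add]
      ring
  have hpolar : ∫ t : ℝ, ∫ ω : ℝ, F (t ^ 2 + ω ^ 2) = ∫ z : ℂ, F (‖z‖ ^ 2) := by
    rw [← integral_prod _ hInt, ← Measure.volume_eq_prod,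
      ← Complex.volume_preserving_equiv_real_prod.integral_comp
        Complex.measurableEquivRealProd.measurableEmbedding]
    refine integral_congr_ae (Eventually.of_forall fun z => ?_)
    simp only [Complex.sq_norm, Complex.normSq_apply, ← sq, Complex.measurableEquivRealProd_apply]
  have hball : (volume : Measure ℂ).real (Metric.ball 0 1) = Real.pi := by
    simp [Measure.real, Complex.volume_ball]
  rw [hscale, hpolar, integral_fun_norm_addHaar volume fun r => F (r ^ 2), hball,
    Complex.finrank_real_complex]
  have h := integral_Ioi_mul_exp_neg_sq hH hK B
  simp only [Nat.add_one_sub_one, pow_one, smul_eq_mul, nsmul_eq_mul, F, h]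
  push_cast
  ring

theorem rho_sq {x : ℝ} (hx : 1 < x) : rho x ^ 2 = (x - 1) / (x + 1) := by
  rw [rho, ← Real.exp_nat_mul, dlt, ← inv_div (x + 1), ← Real.exp_log (x := ((x + 1) / (x - 1))⁻¹),
    Real.log_inv]
  · congr 1
    push_cast
    ring
  · have : 0 < x - 1 := by linarith
    positivity

theorem rho_lt_one {x : ℝ} (hx : 1 < x) : rho x < 1 := by
  have h : rho x ^ 2 < 1 := by
    rw [rho_sq hx, div_lt_one (by linarith)]
    linarith
  nlinarith [Real.exp_pos (-dlt x)]

theorem inv_cosh_dlt (x : ℝ) : (Real.cosh (dlt x))⁻¹ = 2 * rho x / (1 + rho x ^ 2) := by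
  have h : Real.exp (dlt x) = (rho x)⁻¹ := by rw [rho, Real.exp_neg, inv_inv]
  have hρ : 0 < rho x := Real.exp_pos _
  rw [Real.cosh_eq, h, ← rho]
  field_simp

theorem abs_odd_pow_sub_mul_le {ρ c u : ℝ} {k : ℕ} (hρ0 : 0 < ρ) (hρ1 : ρ < 1)
    (hcq : ρ ^ 2 ≤ c) (hc1 : c ≤ 1) (hu : u ∈ Set.Icc ((ρ ^ 2) ^ (k + 1)) ((ρ ^ 2) ^ k)) :
    |ρ ^ (2 * k + 1) - c * u| ≤ 2 * (1 - ρ ^ 2) := by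
  have hq1 : ρ ^ 2 < 1 := pow_lt_one₀ hρ0.le hρ1 two_ne_zero
  have h0 : (ρ ^ 2) ^ k ≤ 1 := pow_le_one₀ (by positivity) hq1.le
  have hu0 : 0 ≤ u := le_trans (by positivity) hu.1
  have hlo : (ρ ^ 2) ^ (k + 1) ≤ ρ ^ (2 * k + 1) := by
    rw [← pow_mul]
    exact pow_le_pow_of_le_one hρ0.le hρ1.le (by omega)
  have hhi : ρ ^ (2 * k + 1) ≤ (ρ ^ 2) ^ k := by
    rw [← pow_mul]
    exact pow_le_pow_of_le_one hρ0.le hρ1.le (by omega)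
  have hlen : (ρ ^ 2) ^ k - (ρ ^ 2) ^ (k + 1) ≤ 1 - ρ ^ 2 := by
    rw [pow_succ (ρ ^ 2) k]
    nlinarith
  have hcu : u - c * u ≤ 1 - ρ ^ 2 := by nlinarith [hu.2]
  have hcu0 : 0 ≤ u - c * u := by nlinarith
  exact abs_le.2 ⟨by linarith [hu.1, hu.2], by linarith [hu.1, hu.2]⟩

/-- Szegő theorem (Theorem 1 of the paper): for `G(x,z) = a(x)·g(b(x)·z)`,
`∑_k G(αβ, λ_k) ≐ (1/(2π)) ∬ G(αβ, σ_A(t,ω)) dt dω` as `αβ → ∞`. -/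
theorem szego_theorem
    (Δ : ℝ) (hΔ : 0 < Δ)
    (g : ℝ → ℝ) (hg : ContinuousOn g (Set.Icc 0 Δ))
    (hg0 : ∃ L : ℝ, Filter.Tendsto (fun x => g x / x) (nhdsWithin 0 (Set.Ioi 0)) (nhds L))
    (a : ℝ → ℝ) (ha : ∃ M : ℝ, ∀ x, 1 < x → |a x| ≤ M)
    (b : ℝ → ℝ) (hb : ∀ x, 1 < x → b x ∈ Set.Icc 0 Δ) :
    ∀ ε > 0, ∃ M, 1 < M ∧ ∀ α β : ℝ, 0 < α → 0 < β → M < α * β →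
      |(∑' k : ℕ, a (α*β) * g (b (α*β) * (rho (α*β))^(2*k+1))) -
        (1/(2*Real.pi)) * ∫ t : ℝ, ∫ ω : ℝ,
          a (α*β) * g (b (α*β) *
            ((Real.cosh (dlt (α*β)))⁻¹ * Real.exp (-(t^2/α^2) - ω^2/β^2)))|
        ≤ ε * (α * β) := by
  intro ε hε
  obtain ⟨L, hL⟩ := hg0
  obtain ⟨A, hA⟩ := ha
  obtain ⟨H, K, hHu, hK, hgH⟩ := exists_uniformContinuous_factor hΔ hg hL
  have hH : Continuous H := hHu.continuous
  have hA0 : 0 ≤ A := (abs_nonneg _).trans (hA 2 (by norm_num))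
  set η : ℝ := ε / (A * Δ + 1) with hη
  have hη0 : 0 < η := by positivity
  obtain ⟨r, hr, hHr⟩ := Metric.uniformContinuous_iff.1 hHu η hη0
  refine ⟨1 + 4 * Δ / r, by simp only [lt_add_iff_pos_right]; positivity, ?_⟩
  intro α β hα hβ hM
  set x := α * β with hxdef
  have hx : 1 < x := lt_trans (by simp only [lt_add_iff_pos_right]; positivity) hM
  have hxr : 4 * Δ < r * (x + 1) := by
    have h : 4 * Δ / r < x + 1 := by linarith
    rwa [div_lt_iff₀ hr, mul_comm (x + 1)] at h
  obtain ⟨hb0, hb1⟩ := hb x hx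
  set c := (Real.cosh (dlt x))⁻¹ with hc
  have hρ0 : 0 < rho x := Real.exp_pos _
  have hρ1 : rho x < 1 := rho_lt_one hx
  have hcρ : c = 2 * rho x / (1 + rho x ^ 2) := inv_cosh_dlt x
  set ρ := rho x with hρ
  have hq : ρ ^ 2 = (x - 1) / (x + 1) := rho_sq hx
  have hc0 : 0 < c := by rw [hcρ]; positivity
  have hc1 : c ≤ 1 := inv_le_one_of_one_le₀ (Real.one_le_cosh _)
  have hcq : ρ ^ 2 ≤ c := by
    rw [hcρ, le_div_iff₀ (by positivity)]
    nlinarith [pow_le_one₀ hρ0.le hρ1.le (n := 3), pow_le_one₀ hρ0.le hρ1.le (n := 1)]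
  have hq1 : ρ ^ 2 < 1 := pow_lt_one₀ hρ0.le hρ1 two_ne_zero
  have hqx : (1 - ρ ^ 2) * (x + 1) = 2 := by
    rw [hq]
    field_simp
    ring
  have hcx : c * x * (1 - ρ ^ 2) = 2 * ρ := by
    have h : x * (1 - ρ ^ 2) = 1 + ρ ^ 2 := by linarith
    rw [mul_assoc, h, hcρ]
    field_simp
  have hpow : ∀ k : ℕ, ρ ^ (2 * k + 1) = c * x / 2 * ((ρ ^ 2) ^ k - (ρ ^ 2) ^ (k + 1)) := fun k => by
    linear_combination (-(ρ ^ 2) ^ k / 2) * hcx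
  have hsum : ∑' k : ℕ, a x * g (b x * ρ ^ (2 * k + 1))
      = a x * b x * (c * x / 2) *
        ∑' k : ℕ, ((ρ ^ 2) ^ k - (ρ ^ 2) ^ (k + 1)) * H (b x * ρ ^ (2 * k + 1)) := by
    rw [← tsum_mul_left]
    refine tsum_congr fun k => ?_
    have h1 : ρ ^ (2 * k + 1) ≤ 1 := pow_le_one₀ hρ0.le hρ1.le
    rw [hgH _ ⟨by positivity, by nlinarith⟩]
    linear_combination (a x * b x * H (b x * ρ ^ (2 * k + 1))) * hpow k
  have hintegral : ∫ t : ℝ, ∫ ω : ℝ, a x * g (b x *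
        (c * Real.exp (-(t ^ 2 / α ^ 2) - ω ^ 2 / β ^ 2)))
      = a x * (Real.pi * x * (b x * c * ∫ u in (0 : ℝ)..1, H (b x * c * u))) := by
    have hscale : b x * c * ∫ u in (0 : ℝ)..1, H (b x * c * u) = ∫ u in (0 : ℝ)..b x * c, H u := by
      simp
    rw [hscale, ← integral_integral_gaussian hH hK (b x * c) hα hβ, ← integral_const_mul]
    refine integral_congr_ae (Filter.Eventually.of_forall fun t => ?_)
    dsimp only
    rw [← integral_const_mul]
    refine integral_congr_ae (Filter.Eventually.of_forall fun ω => ?_)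
    dsimp only
    have hE : Real.exp (-(t ^ 2 / α ^ 2) - ω ^ 2 / β ^ 2) ≤ 1 :=
      Real.exp_le_one_iff.2 (by have := sq_nonneg (t / α); have := sq_nonneg (ω / β)
                                rw [div_pow] at *; linarith)
    have hE0 := Real.exp_pos (-(t ^ 2 / α ^ 2) - ω ^ 2 / β ^ 2)
    have hcE : c * Real.exp (-(t ^ 2 / α ^ 2) - ω ^ 2 / β ^ 2) ≤ 1 := mul_le_one₀ hc1 hE0.le hE
    rw [hgH _ ⟨by positivity, by nlinarith⟩, ← mul_assoc (b x) c]
  have hs : Summable fun k : ℕ =>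
      ((ρ ^ 2) ^ k - (ρ ^ 2) ^ (k + 1)) * H (b x * ρ ^ (2 * k + 1)) := by
    refine Summable.of_norm_bounded (g := fun k : ℕ => (ρ ^ 2) ^ k * K)
      ((summable_geometric_of_lt_one (by positivity) hq1).mul_right K) fun k => ?_
    have h0 : 0 < (ρ ^ 2) ^ k := by positivity
    have h1 : (ρ ^ 2) ^ (k + 1) ≤ (ρ ^ 2) ^ k :=
      pow_le_pow_of_le_one (by positivity) hq1.le (Nat.le_succ k)
    have h2 : 0 < (ρ ^ 2) ^ (k + 1) := by positivity
    rw [norm_mul, Real.norm_eq_abs, Real.norm_eq_abs, abs_of_nonneg (sub_nonneg.2 h1)]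
    exact mul_le_mul (by linarith) (hK _) (abs_nonneg _) h0.le
  have hriemann := abs_tsum_geometric_sub_integral_le (q := ρ ^ 2) (η := η)
    (f := fun u => H (b x * c * u)) (v := fun k => H (b x * ρ ^ (2 * k + 1)))
    (by positivity) hq1 (by fun_prop) (fun k u hu => by
      have hd := abs_odd_pow_sub_mul_le hρ0 hρ1 hcq hc1 hu
      refine (hHr ?_).le
      rw [Real.dist_eq, mul_assoc, ← mul_sub, abs_mul, abs_of_nonneg hb0]
      calc b x * |ρ ^ (2 * k + 1) - c * u| ≤ Δ * (2 * (1 - ρ ^ 2)) :=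
            mul_le_mul hb1 hd (abs_nonneg _) hΔ.le
        _ < r := by
            refine lt_of_mul_lt_mul_right ?_ (by linarith : 0 ≤ x + 1)
            linear_combination hxr + 2 * Δ * hqx) hs
  rw [hsum, hintegral]
  set T := ∑' k : ℕ, ((ρ ^ 2) ^ k - (ρ ^ 2) ^ (k + 1)) * H (b x * ρ ^ (2 * k + 1))
  set J := ∫ u in (0 : ℝ)..1, H (b x * c * u)
  have hdiff : a x * b x * (c * x / 2) * T
      - 1 / (2 * Real.pi) * (a x * (Real.pi * x * (b x * c * J)))
      = a x * (b x * (c * (x / 2 * (T - J)))) := by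
    have := Real.pi_ne_zero
    field_simp
  have hx0 : 0 < x := by linarith
  rw [hdiff, abs_mul, abs_mul, abs_mul, abs_mul, abs_of_nonneg hb0, abs_of_pos hc0,
    abs_of_pos (half_pos hx0)]
  calc |a x| * (b x * (c * (x / 2 * |T - J|)))
      ≤ A * (Δ * (1 * (x / 2 * η))) := by
        have hAx := hA x hx
        gcongr
    _ = A * Δ * η / 2 * x := by ring
    _ ≤ ε * x := by
        have : (A * Δ + 1) * η = ε := by rw [hη]; field_simp
        have : 0 ≤ A * Δ * η := by positivity
        gcongr
        linarith
end
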